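/- arXiv:2505.23144 — 11 statements merged into one kernel-verified Lean document; each statement's English description precedes it below -/
import Mathlib

section
/- For every x ∈ I, (h u² + (g/2) h² + Σ_{i=1}^N h α_i²/(2i+1))'(x) + g h(x) Z'(x) = u(x) (h u)'(x) + h(x) · (u²/2 + g(h+Z) + (3/2) Σ_{i=1}^N α_i²/(2i+1))'(x) − Σ_{i=1}^N (h(x)² α_i(x)/(2i+1)) · (α_i/h)'(x). -/
/-- For differentiable `h, u, Z, α_i` with `h > 0` on an open interval `I`:
`(hu² + (g/2)h² + Σ h α_i²/(2i+1))' + g h Z'`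
`= u (hu)' + h (u²/2 + g(h+Z) + (3/2) Σ α_i²/(2i+1))' - Σ (h² α_i/(2i+1)) (α_i/h)'`
at every point of `I`.  (Here `i : Fin N` represents the 1-based index `i+1`, so
the weight `2i+1` becomes `2i+3`.) -/
theorem momentum_equation_identity {N : ℕ} (hN : 1 ≤ N) (g : ℝ) (hg : 0 < g)
    (I : Set ℝ) (hI : IsOpen I) (hIconn : Convex ℝ I)
    (h u Z : ℝ → ℝ) (α : Fin N → ℝ → ℝ)
    (hhd : ∀ x ∈ I, DifferentiableAt ℝ h x)
    (hud : ∀ x ∈ I, DifferentiableAt ℝ u x)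
    (hZd : ∀ x ∈ I, DifferentiableAt ℝ Z x)
    (hαd : ∀ i : Fin N, ∀ x ∈ I, DifferentiableAt ℝ (α i) x)
    (hpos : ∀ x ∈ I, 0 < h x) :
    ∀ x ∈ I,
      deriv (fun y => h y * (u y) ^ 2 + g / 2 * (h y) ^ 2
          + ∑ i : Fin N, h y * (α i y) ^ 2 / (2 * ((i : ℕ) : ℝ) + 3)) x
        + g * h x * deriv Z x
      = u x * deriv (fun y => h y * u y) x
        + h x * deriv (fun y => (u y) ^ 2 / 2 + g * (h y + Z y)
            + 3 / 2 * ∑ i : Fin N, (α i y) ^ 2 / (2 * ((i : ℕ) : ℝ) + 3)) x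
        - ∑ i : Fin N, (h x) ^ 2 * α i x / (2 * ((i : ℕ) : ℝ) + 3)
            * deriv (fun y => α i y / h y) x := by
  intro x hx
  have hh := (hhd x hx).hasDerivAt
  have hu := (hud x hx).hasDerivAt
  have hZ := (hZd x hx).hasDerivAt
  have hα : ∀ i, HasDerivAt (α i) (deriv (α i) x) x := fun i => (hαd i x hx).hasDerivAt
  have hx0 : h x ≠ 0 := (hpos x hx).ne'
  have flux := ((hh.mul (hu.pow 2)).add ((hh.pow 2).const_mul (g / 2))).add
    (HasDerivAt.fun_sum fun i (_ : i ∈ Finset.univ) =>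
      (hh.mul ((hα i).pow 2)).div_const (2 * ((i : ℕ) : ℝ) + 3))
  have head := (((hu.pow 2).div_const 2).add ((hh.add hZ).const_mul g)).add
    ((HasDerivAt.fun_sum fun i (_ : i ∈ Finset.univ) =>
      ((hα i).pow 2).div_const (2 * ((i : ℕ) : ℝ) + 3)).const_mul (3 / 2))
  have ratio : ∀ i, deriv (fun y => α i y / h y) x
      = (deriv (α i) x * h x - α i x * deriv h x) / h x ^ 2 :=
    fun i => ((hα i).div hh hx0).deriv
  have moment : deriv (fun y => h y * u y) x = deriv h x * u x + h x * deriv u x :=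
    (hh.mul hu).deriv
  have sums : ∑ i : Fin N, (deriv h x * α i x ^ 2 + h x * (2 * α i x * deriv (α i) x))
        / (2 * ((i : ℕ) : ℝ) + 3)
      = h x * (3 / 2 * ∑ i : Fin N, 2 * α i x * deriv (α i) x / (2 * ((i : ℕ) : ℝ) + 3))
        - ∑ i : Fin N, h x ^ 2 * α i x / (2 * ((i : ℕ) : ℝ) + 3)
          * ((deriv (α i) x * h x - α i x * deriv h x) / h x ^ 2) := by
    rw [Finset.mul_sum, Finset.mul_sum, ← Finset.sum_sub_distrib]
    refine Finset.sum_congr rfl fun i _ => ?_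
    have hw : (2 * ((i : ℕ) : ℝ) + 3) ≠ 0 := by positivity
    field_simp
    ring
  simp only [ratio, moment]
  erw [flux.deriv, head.deriv]
  simp only [Pi.pow_apply, Nat.cast_ofNat, Nat.add_one_sub_one, pow_one]
  linear_combination sums
end

section
/- With q, E, E_1, …, E_N as above, for every x ∈ I the following identities hold: (i) (hu)' = q'; (ii) (hu² + (g/2)h² + Σ_{i=1}^N h α_i²/(2i+1))' + g h Z' − P_0 = u q' + h E' − Σ_{i=1}^N (h² α_i/(2i+1)) (E_i)'; (iii) for each i = 1,…,N, (2huα_i)' − u(hα_i)' − P_i = 2α_i q' + h² u (E_i)'. Equivalently, the steady-state residual vector of the HSWLME equals the matrix–vector product M · (q', E', E_1', …, E_N')ᵀ, where M is the matrix defined above evaluated at (h(x), u(x), α_1(x), …, α_N(x)). -/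
/-- The coefficients `a_{i,j}` (with 1-based indices `i, j`). -/
noncomputable def aCoef (i j : ℕ) : ℝ :=
  if (i + j) % 2 = 0 then 0
  else ((min (i - 1) j : ℕ) : ℝ) * (((min (i - 1) j : ℕ) : ℝ) + 1) / 2

/-- The friction term `P_0 = -(ν/λ)(u + Σ_{j=1}^N α_j)`. -/
noncomputable def frictionP0 {N : ℕ} (ν lam : ℝ) (u : ℝ → ℝ) (α : Fin N → ℝ → ℝ)
    (x : ℝ) : ℝ :=
  -(ν / lam) * (u x + ∑ j : Fin N, α j x)

/-- The friction term `P_i` (here `i : Fin N` represents the 1-based index `i+1`,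
so the factor `2i+1` becomes `2i+3`). -/
noncomputable def frictionP {N : ℕ} (ν lam : ℝ) (h u : ℝ → ℝ) (α : Fin N → ℝ → ℝ)
    (i : Fin N) (x : ℝ) : ℝ :=
  -(ν / lam) * (2 * ((i : ℕ) : ℝ) + 3) * (u x + ∑ j : Fin N, α j x)
    - 4 * ν / h x * (2 * ((i : ℕ) : ℝ) + 3) *
        ∑ j : Fin N, aCoef ((i : ℕ) + 1) ((j : ℕ) + 1) * α j x

/-- The `(N+2)×(N+2)` matrix `M`: row 0 is `(1,0,…,0)`; row 1 is
`(u, h, -h²α_1/3, …, -h²α_N/(2N+1))`; for `i = 1,…,N`, row `i+1` has `2α_i`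
in column 0, `h²u` in column `i+1`, and zeros elsewhere. -/
noncomputable def Mmat (N : ℕ) (h u : ℝ) (α : Fin N → ℝ) :
    Matrix (Fin (N + 2)) (Fin (N + 2)) ℝ :=
  Matrix.of fun r c =>
    if (r : ℕ) = 0 then (if (c : ℕ) = 0 then 1 else 0)
    else if (r : ℕ) = 1 then
      if (c : ℕ) = 0 then u
      else if (c : ℕ) = 1 then h
      else if hc : 2 ≤ (c : ℕ) then
        -(h ^ 2) * α ⟨(c : ℕ) - 2, by have := c.isLt; omega⟩
          / (2 * ((((c : ℕ) - 2 : ℕ)) : ℝ) + 3)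
      else 0
    else
      if (c : ℕ) = 0 then
        (if hr : 2 ≤ (r : ℕ) then 2 * α ⟨(r : ℕ) - 2, by have := r.isLt; omega⟩ else 0)
      else if c = r then h ^ 2 * u
      else 0

theorem Mmat_mulVec_zero {N : ℕ} (h u : ℝ) (α : Fin N → ℝ) (w : Fin (N + 2) → ℝ) :
    (Mmat N h u α).mulVec w 0 = w 0 := by
  simp [Matrix.mulVec, dotProduct, Mmat]

theorem Mmat_mulVec_one {N : ℕ} (h u : ℝ) (α : Fin N → ℝ) (w : Fin (N + 2) → ℝ) :
    (Mmat N h u α).mulVec w 1 = u * w 0 + h * w 1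
      - ∑ i : Fin N, h ^ 2 * α i / (2 * ((i : ℕ) : ℝ) + 3) * w i.succ.succ := by
  simp [Matrix.mulVec, dotProduct, Mmat, Fin.sum_univ_succ, neg_div, sub_eq_add_neg, add_assoc]

theorem Mmat_mulVec_succ_succ {N : ℕ} (h u : ℝ) (α : Fin N → ℝ) (w : Fin (N + 2) → ℝ)
    (i : Fin N) :
    (Mmat N h u α).mulVec w i.succ.succ = 2 * α i * w 0 + h ^ 2 * u * w i.succ.succ := by
  simp [Matrix.mulVec, dotProduct, Mmat, Fin.sum_univ_succ]

/-- With equilibrium variables `q = hu`, `E = u²/2 + g(h+Z) + (3/2)Σ α_i²/(2i+1) - Pint`,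
`E_i = α_i/h - Pint_i`, the steady-state residual of the HSWLME can be written componentwise as
(i) `(hu)' = q'`; (ii) momentum residual `= u q' + h E' - Σ (h²α_i/(2i+1)) E_i'`;
(iii) `(2huα_i)' - u(hα_i)' - P_i = 2α_i q' + h²u E_i'`; equivalently, the residual vector
equals `M ⬝ (q', E', E_1', …, E_N')ᵀ`. -/
theorem steady_residual_eq_M_mulVec {N : ℕ} (hN : 1 ≤ N) (g ν lam : ℝ)
    (hg : 0 < g) (hν : 0 ≤ ν) (hlam : 0 < lam)
    (I : Set ℝ) (hI : IsOpen I) (hIconn : Convex ℝ I)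
    (h u Z : ℝ → ℝ) (α : Fin N → ℝ → ℝ)
    (hhd : ∀ x ∈ I, DifferentiableAt ℝ h x)
    (hud : ∀ x ∈ I, DifferentiableAt ℝ u x)
    (hZd : ∀ x ∈ I, DifferentiableAt ℝ Z x)
    (hαd : ∀ i : Fin N, ∀ x ∈ I, DifferentiableAt ℝ (α i) x)
    (hpos : ∀ x ∈ I, 0 < h x) (hune : ∀ x ∈ I, u x ≠ 0)
    (Pint : ℝ → ℝ) (Pinti : Fin N → ℝ → ℝ)
    (hPintd : ∀ x ∈ I, DifferentiableAt ℝ Pint x)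
    (hPintid : ∀ i : Fin N, ∀ x ∈ I, DifferentiableAt ℝ (Pinti i) x)
    (hPint : ∀ x ∈ I, deriv Pint x = frictionP0 ν lam u α x / h x
        + ∑ i : Fin N, frictionP ν lam h u α i x * α i x
            / ((2 * ((i : ℕ) : ℝ) + 3) * h x * u x))
    (hPinti : ∀ i : Fin N, ∀ x ∈ I,
        deriv (Pinti i) x = frictionP ν lam h u α i x / ((h x) ^ 2 * u x))
    (q E : ℝ → ℝ) (Ei : Fin N → ℝ → ℝ)
    (hq : ∀ x, q x = h x * u x)
    (hE : ∀ x, E x = (u x) ^ 2 / 2 + g * (h x + Z x)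
        + 3 / 2 * ∑ i : Fin N, (α i x) ^ 2 / (2 * ((i : ℕ) : ℝ) + 3) - Pint x)
    (hEi : ∀ i : Fin N, ∀ x, Ei i x = α i x / h x - Pinti i x) :
    ∀ x ∈ I,
      (deriv (fun y => h y * u y) x = deriv q x) ∧
      (deriv (fun y => h y * (u y) ^ 2 + g / 2 * (h y) ^ 2
            + ∑ i : Fin N, h y * (α i y) ^ 2 / (2 * ((i : ℕ) : ℝ) + 3)) x
          + g * h x * deriv Z x - frictionP0 ν lam u α x
        = u x * deriv q x + h x * deriv E x
          - ∑ i : Fin N, (h x) ^ 2 * α i x / (2 * ((i : ℕ) : ℝ) + 3) * deriv (Ei i) x) ∧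
      (∀ i : Fin N,
        deriv (fun y => 2 * h y * u y * α i y) x
            - u x * deriv (fun y => h y * α i y) x - frictionP ν lam h u α i x
          = 2 * α i x * deriv q x + (h x) ^ 2 * u x * deriv (Ei i) x) ∧
      ((fun r : Fin (N + 2) =>
          if (r : ℕ) = 0 then deriv (fun y => h y * u y) x
          else if (r : ℕ) = 1 then
            deriv (fun y => h y * (u y) ^ 2 + g / 2 * (h y) ^ 2
                + ∑ i : Fin N, h y * (α i y) ^ 2 / (2 * ((i : ℕ) : ℝ) + 3)) x
              + g * h x * deriv Z x - frictionP0 ν lam u α x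
          else if hr : 2 ≤ (r : ℕ) then
            deriv (fun y => 2 * h y * u y
                * α ⟨(r : ℕ) - 2, by have := r.isLt; omega⟩ y) x
              - u x * deriv (fun y => h y
                  * α ⟨(r : ℕ) - 2, by have := r.isLt; omega⟩ y) x
              - frictionP ν lam h u α ⟨(r : ℕ) - 2, by have := r.isLt; omega⟩ x
          else 0)
        = (Mmat N (h x) (u x) (fun i => α i x)).mulVec
            (fun r : Fin (N + 2) =>
              if (r : ℕ) = 0 then deriv q x
              else if (r : ℕ) = 1 then deriv E x
              else if hr : 2 ≤ (r : ℕ) then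
                deriv (Ei ⟨(r : ℕ) - 2, by have := r.isLt; omega⟩) x
              else 0)) := by
  intro x hx
  have hh := (hhd x hx).hasDerivAt
  have hu := (hud x hx).hasDerivAt
  have hα := fun i => (hαd i x hx).hasDerivAt
  have hne : h x ≠ 0 := (hpos x hx).ne'
  have une := hune x hx
  have hc : ∀ i : Fin N, (2 * ((i : ℕ) : ℝ) + 3) ≠ 0 := fun i => by positivity
  obtain rfl : q = fun y => h y * u y := funext hq
  have dq : deriv (fun y => h y * u y) x = deriv h x * u x + h x * deriv u x :=
    (hh.mul hu).deriv
  have dE : deriv E x = u x * deriv u x + g * (deriv h x + deriv Z x)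
      + 3 * ∑ i : Fin N, α i x * deriv (α i) x / (2 * ((i : ℕ) : ℝ) + 3) - deriv Pint x := by
    rw [funext hE]
    have key := ((((hu.pow 2).div_const 2).add
      ((hh.add (hZd x hx).hasDerivAt).const_mul g)).add
      ((HasDerivAt.fun_sum (u := Finset.univ) fun i _ =>
        ((hα i).pow 2).div_const (2 * ((i : ℕ) : ℝ) + 3)).const_mul (3 / 2))).sub
      (hPintd x hx).hasDerivAt
    refine key.deriv.trans ?_
    simp only [Finset.mul_sum]
    congr 2
    · norm_num
      ring
    · refine Finset.sum_congr rfl fun i _ => ?_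
      norm_num
      ring
  have dEi : ∀ i, deriv (Ei i) x
      = (deriv (α i) x * h x - α i x * deriv h x) / h x ^ 2 - deriv (Pinti i) x := fun i => by
    rw [funext (hEi i)]
    exact (((hα i).div hh hne).sub (hPintid i x hx).hasDerivAt).deriv
  have dflux : deriv (fun y => h y * (u y) ^ 2 + g / 2 * (h y) ^ 2
        + ∑ i : Fin N, h y * (α i y) ^ 2 / (2 * ((i : ℕ) : ℝ) + 3)) x
      = deriv h x * u x ^ 2 + 2 * h x * u x * deriv u x + g * h x * deriv h x
        + ∑ i : Fin N, (deriv h x * α i x ^ 2 + 2 * h x * α i x * deriv (α i) x)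
          / (2 * ((i : ℕ) : ℝ) + 3) := by
    have key := ((hh.mul (hu.pow 2)).add ((hh.pow 2).const_mul (g / 2))).add
      (HasDerivAt.fun_sum (u := Finset.univ) fun i _ =>
        (hh.mul ((hα i).pow 2)).div_const (2 * ((i : ℕ) : ℝ) + 3))
    refine key.deriv.trans ?_
    congr 1
    · norm_num
      ring
    · refine Finset.sum_congr rfl fun i _ => ?_
      norm_num
      ring
  have momentum : deriv (fun y => h y * (u y) ^ 2 + g / 2 * (h y) ^ 2
            + ∑ i : Fin N, h y * (α i y) ^ 2 / (2 * ((i : ℕ) : ℝ) + 3)) x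
          + g * h x * deriv Z x - frictionP0 ν lam u α x
        = u x * deriv (fun y => h y * u y) x + h x * deriv E x
          - ∑ i : Fin N, (h x) ^ 2 * α i x / (2 * ((i : ℕ) : ℝ) + 3) * deriv (Ei i) x := by
    have hsum : ∑ i : Fin N, (h x) ^ 2 * α i x / (2 * ((i : ℕ) : ℝ) + 3) * deriv (Ei i) x
        = h x * (3 * ∑ i : Fin N, α i x * deriv (α i) x / (2 * ((i : ℕ) : ℝ) + 3))
          - h x * (∑ i : Fin N, frictionP ν lam h u α i x * α i x
            / ((2 * ((i : ℕ) : ℝ) + 3) * h x * u x))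
          - ∑ i : Fin N, (deriv h x * α i x ^ 2 + 2 * h x * α i x * deriv (α i) x)
            / (2 * ((i : ℕ) : ℝ) + 3) := by
      simp only [Finset.mul_sum, ← Finset.sum_sub_distrib]
      refine Finset.sum_congr rfl fun i _ => ?_
      rw [dEi, hPinti i x hx]
      have := hc i
      field_simp
      ring
    rw [hsum, dflux, dq, dE, hPint x hx]
    field_simp
    ring
  have moment : ∀ i : Fin N, deriv (fun y => 2 * h y * u y * α i y) x
            - u x * deriv (fun y => h y * α i y) x - frictionP ν lam h u α i x
          = 2 * α i x * deriv (fun y => h y * u y) x + (h x) ^ 2 * u x * deriv (Ei i) x := by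
    intro i
    have d2 : deriv (fun y => 2 * h y * u y * α i y) x = _ :=
      (((hh.const_mul 2).mul hu).mul (hα i)).deriv
    have d1 : deriv (fun y => h y * α i y) x = _ := (hh.mul (hα i)).deriv
    rw [d2, d1, dq, dEi, hPinti i x hx]
    simp only [Pi.mul_apply]
    field_simp
    ring
  refine ⟨rfl, momentum, moment, ?_⟩
  funext r
  refine Fin.cases ?_ (fun r => Fin.cases ?_ (fun i => ?_) r) r
  · rw [Mmat_mulVec_zero]
    rfl
  · refine momentum.trans ?_
    rw [Fin.succ_zero_eq_one, Mmat_mulVec_one]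
    simp
  · rw [Mmat_mulVec_succ_succ]
    simpa using moment i
end

section
/- If the functions q = hu, E, and E_i (i = 1,…,N) are all constant on I, then (h, u, α_1, …, α_N) satisfies the HSWLME steady-state equations on I. -/
/-- The HSWLME steady-state equations on `I`:
`(hu)' = 0`, `(hu² + (g/2)h² + Σ h α_i²/(2i+1))' = -g h Z' + P_0`, and
`(2 h u α_i)' = u (h α_i)' + P_i` for all `i`. -/
def IsSteadyState {N : ℕ} (g ν lam : ℝ) (I : Set ℝ) (h u Z : ℝ → ℝ)
    (α : Fin N → ℝ → ℝ) : Prop :=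
  (∀ x ∈ I, deriv (fun y => h y * u y) x = 0) ∧
  (∀ x ∈ I, deriv (fun y => h y * (u y) ^ 2 + g / 2 * (h y) ^ 2
      + ∑ i : Fin N, h y * (α i y) ^ 2 / (2 * ((i : ℕ) : ℝ) + 3)) x
    = -(g * h x * deriv Z x) + frictionP0 ν lam u α x) ∧
  (∀ i : Fin N, ∀ x ∈ I, deriv (fun y => 2 * h y * u y * α i y) x
    = u x * deriv (fun y => h y * α i y) x + frictionP ν lam h u α i x)

/-- A function which is constant on an open set has zero derivative there. -/
theorem HasDerivAt.eq_zero_of_const_on_isOpen {f : ℝ → ℝ} {f' c x : ℝ} {I : Set ℝ}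
    (hf : HasDerivAt f f' x) (hI : IsOpen I) (hx : x ∈ I) (hc : ∀ y ∈ I, f y = c) :
    f' = 0 :=
  hf.unique ((hasDerivAt_const x c).congr_of_eventuallyEq
    (Filter.eventually_of_mem (hI.mem_nhds hx) hc))

/-- If the equilibrium variables `q = hu`, `E = u²/2 + g(h+Z) + (3/2)Σ α_i²/(2i+1) - 𝒫`
and `E_i = α_i/h - 𝒫_i` are all constant on `I`, then `(h,u,α)` satisfies the
HSWLME steady-state equations on `I`. -/
theorem constant_equilibrium_vars_implies_steadyState {N : ℕ} (hN : 1 ≤ N)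
    (g ν lam : ℝ) (hg : 0 < g) (hν : 0 ≤ ν) (hlam : 0 < lam)
    (I : Set ℝ) (hI : IsOpen I) (hIconn : Convex ℝ I)
    (h u Z : ℝ → ℝ) (α : Fin N → ℝ → ℝ)
    (hhd : ∀ x ∈ I, DifferentiableAt ℝ h x)
    (hud : ∀ x ∈ I, DifferentiableAt ℝ u x)
    (hZd : ∀ x ∈ I, DifferentiableAt ℝ Z x)
    (hαd : ∀ i : Fin N, ∀ x ∈ I, DifferentiableAt ℝ (α i) x)
    (hpos : ∀ x ∈ I, 0 < h x) (hune : ∀ x ∈ I, u x ≠ 0)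
    (Pint : ℝ → ℝ) (Pinti : Fin N → ℝ → ℝ)
    (hPd : ∀ x ∈ I, DifferentiableAt ℝ Pint x)
    (hPid : ∀ i : Fin N, ∀ x ∈ I, DifferentiableAt ℝ (Pinti i) x)
    (hP : ∀ x ∈ I, deriv Pint x = frictionP0 ν lam u α x / h x
        + ∑ i : Fin N, frictionP ν lam h u α i x * α i x
            / ((2 * ((i : ℕ) : ℝ) + 3) * h x * u x))
    (hPi : ∀ i : Fin N, ∀ x ∈ I,
        deriv (Pinti i) x = frictionP ν lam h u α i x / ((h x) ^ 2 * u x))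
    (hq : ∃ c : ℝ, ∀ x ∈ I, h x * u x = c)
    (hE : ∃ c : ℝ, ∀ x ∈ I, (u x) ^ 2 / 2 + g * (h x + Z x)
        + 3 / 2 * ∑ i : Fin N, (α i x) ^ 2 / (2 * ((i : ℕ) : ℝ) + 3) - Pint x = c)
    (hEi : ∀ i : Fin N, ∃ c : ℝ, ∀ x ∈ I, α i x / h x - Pinti i x = c) :
    IsSteadyState g ν lam I h u Z α := by
  obtain ⟨cq, hq⟩ := hq
  obtain ⟨cE, hE⟩ := hE
  have weight_ne (i : Fin N) : 2 * ((i : ℕ) : ℝ) + 3 ≠ 0 := by positivity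
  have mass : ∀ x ∈ I, deriv h x * u x + h x * deriv u x = 0 := fun x hx =>
    ((hhd x hx).hasDerivAt.mul (hud x hx).hasDerivAt).eq_zero_of_const_on_isOpen hI hx hq
  have moment : ∀ i : Fin N, ∀ x ∈ I, frictionP ν lam h u α i x
      = u x * (deriv (α i) x * h x - α i x * deriv h x) := by
    intro i x hx
    obtain ⟨c, hc⟩ := hEi i
    have hh := (hpos x hx).ne'
    have hu := hune x hx
    have key := (((hαd i x hx).hasDerivAt.div (hhd x hx).hasDerivAt hh).sub
      (hPid i x hx).hasDerivAt).eq_zero_of_const_on_isOpen hI hx hc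
    rw [hPi i x hx] at key
    field_simp at key
    linarith
  refine ⟨fun x hx => ?_, fun x hx => ?_, fun i x hx => ?_⟩
  · exact ((hhd x hx).hasDerivAt.mul (hud x hx).hasDerivAt).deriv.trans (mass x hx)
  · have hh := (hpos x hx).ne'
    have hu := hune x hx
    have dh := (hhd x hx).hasDerivAt
    have du := (hud x hx).hasDerivAt
    have energy := ((((du.pow 2).div_const 2).add
      ((dh.add (hZd x hx).hasDerivAt).const_mul g)).add
      ((HasDerivAt.fun_sum (u := Finset.univ) fun (i : Fin N) _ =>
        ((hαd i x hx).hasDerivAt.pow 2).div_const (2 * ((i : ℕ) : ℝ) + 3)).const_mul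
        (3 / 2))).sub (hPd x hx).hasDerivAt |>.eq_zero_of_const_on_isOpen hI hx hE
    have flux := ((dh.mul (du.pow 2)).add ((dh.pow 2).const_mul (g / 2))).add
      (HasDerivAt.fun_sum (u := Finset.univ) fun (i : Fin N) _ =>
        (dh.mul ((hαd i x hx).hasDerivAt.pow 2)).div_const (2 * ((i : ℕ) : ℝ) + 3))
    refine flux.deriv.trans ?_
    have sums : ∑ i : Fin N, (deriv h x * (α i x) ^ 2
          + h x * (2 * α i x * deriv (α i) x)) / (2 * ((i : ℕ) : ℝ) + 3)
        = h x * (3 / 2 * ∑ i : Fin N, 2 * α i x * deriv (α i) x / (2 * ((i : ℕ) : ℝ) + 3))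
          - h x * ∑ i : Fin N, frictionP ν lam h u α i x * α i x
            / ((2 * ((i : ℕ) : ℝ) + 3) * h x * u x) := by
      simp only [Finset.mul_sum, ← Finset.sum_sub_distrib]
      refine Finset.sum_congr rfl fun i _ => ?_
      have hw := weight_ne i
      rw [moment i x hx]
      field_simp
      ring
    have hP0 : h x * (frictionP0 ν lam u α x / h x) = frictionP0 ν lam u α x :=
      mul_div_cancel₀ _ hh
    rw [hP x hx] at energy
    simp only [Pi.pow_apply, Nat.cast_ofNat, Nat.add_one_sub_one, pow_one] at energy ⊢
    rw [sums]
    linear_combination h x * energy + u x * mass x hx + hP0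
  · have dh := (hhd x hx).hasDerivAt
    have da := (hαd i x hx).hasDerivAt
    have left := ((dh.const_mul 2).mul (hud x hx).hasDerivAt).mul da
    have right := dh.mul da
    refine left.deriv.trans ?_
    rw [show deriv (fun y => h y * α i y) x = _ from right.deriv, moment i x hx]
    simp only [Pi.mul_apply]
    linear_combination 2 * α i x * mass x hx
end

section
/- If (h, u, α_1, …, α_N) satisfies the HSWLME steady-state equations on I, then the functions q = hu, E, and E_i (i = 1,…,N) are constant on I. -/
theorem exists_const_of_hasDerivAt_zero {I : Set ℝ} (hI : IsOpen I) (hIconn : Convex ℝ I)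
    {f : ℝ → ℝ} (hf : ∀ x ∈ I, HasDerivAt f 0 x) : ∃ c : ℝ, ∀ x ∈ I, f x = c :=
  hI.exists_is_const_of_deriv_eq_zero hIconn.isPreconnected
    (fun x hx => (hf x hx).differentiableAt.differentiableWithinAt)
    (fun x hx => (hf x hx).deriv)

/-- If `(h,u,α)` satisfies the HSWLME steady-state equations on the open interval `I`,
then the equilibrium variables `q = hu`, `E = u²/2 + g(h+Z) + (3/2)Σ α_i²/(2i+1) - 𝒫`
and `E_i = α_i/h - 𝒫_i` are all constant on `I`. -/
theorem steadyState_implies_constant_equilibrium_vars {N : ℕ} (hN : 1 ≤ N)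
    (g ν lam : ℝ) (hg : 0 < g) (hν : 0 ≤ ν) (hlam : 0 < lam)
    (I : Set ℝ) (hI : IsOpen I) (hIconn : Convex ℝ I)
    (h u Z : ℝ → ℝ) (α : Fin N → ℝ → ℝ)
    (hhd : ∀ x ∈ I, DifferentiableAt ℝ h x)
    (hud : ∀ x ∈ I, DifferentiableAt ℝ u x)
    (hZd : ∀ x ∈ I, DifferentiableAt ℝ Z x)
    (hαd : ∀ i : Fin N, ∀ x ∈ I, DifferentiableAt ℝ (α i) x)
    (hpos : ∀ x ∈ I, 0 < h x) (hune : ∀ x ∈ I, u x ≠ 0)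
    (Pint : ℝ → ℝ) (Pinti : Fin N → ℝ → ℝ)
    (hPd : ∀ x ∈ I, DifferentiableAt ℝ Pint x)
    (hPid : ∀ i : Fin N, ∀ x ∈ I, DifferentiableAt ℝ (Pinti i) x)
    (hP : ∀ x ∈ I, deriv Pint x = frictionP0 ν lam u α x / h x
        + ∑ i : Fin N, frictionP ν lam h u α i x * α i x
            / ((2 * ((i : ℕ) : ℝ) + 3) * h x * u x))
    (hPi : ∀ i : Fin N, ∀ x ∈ I,
        deriv (Pinti i) x = frictionP ν lam h u α i x / ((h x) ^ 2 * u x))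
    (hss : IsSteadyState g ν lam I h u Z α) :
    (∃ c : ℝ, ∀ x ∈ I, h x * u x = c) ∧
    (∃ c : ℝ, ∀ x ∈ I, (u x) ^ 2 / 2 + g * (h x + Z x)
        + 3 / 2 * ∑ i : Fin N, (α i x) ^ 2 / (2 * ((i : ℕ) : ℝ) + 3) - Pint x = c) ∧
    (∀ i : Fin N, ∃ c : ℝ, ∀ x ∈ I, α i x / h x - Pinti i x = c) := by
  obtain ⟨hmass, hmom, hmoment⟩ := hss
  have hcont : ∀ x ∈ I, deriv h x * u x + h x * deriv u x = 0 := fun x hx => by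
    rw [← hmass x hx]
    exact ((hhd x hx).hasDerivAt.mul (hud x hx).hasDerivAt).deriv.symm
  have hαeq : ∀ i, ∀ x ∈ I, h x * u x * deriv (α i) x - u x * deriv h x * α i x
      = frictionP ν lam h u α i x := fun i x hx => by
    have e := hmoment i x hx
    have d1 := ((((hhd x hx).hasDerivAt.const_mul 2).mul (hud x hx).hasDerivAt).mul
      (hαd i x hx).hasDerivAt).deriv
    have d2 := ((hhd x hx).hasDerivAt.mul (hαd i x hx).hasDerivAt).deriv
    simp only [Pi.mul_def] at d1 d2
    rw [d1, d2] at e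
    linear_combination e - 2 * α i x * hcont x hx
  refine ⟨?_, ?_, fun i => ?_⟩
  · refine exists_const_of_hasDerivAt_zero hI hIconn fun x hx => ?_
    rw [← hcont x hx]
    exact (hhd x hx).hasDerivAt.mul (hud x hx).hasDerivAt
  · refine exists_const_of_hasDerivAt_zero hI hIconn fun x hx => ?_
    have hh := (hpos x hx).ne'
    have hu := hune x hx
    have dh := (hhd x hx).hasDerivAt
    have du := (hud x hx).hasDerivAt
    have hc : ∀ i : Fin N, (2 * ((i : ℕ) : ℝ) + 3) ≠ 0 := fun i => by positivity
    have e := hmom x hx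
    have d1 := (((dh.mul (du.pow 2)).add ((dh.pow 2).const_mul (g / 2))).add
      (HasDerivAt.fun_sum (u := Finset.univ) fun i _ =>
        (dh.mul ((hαd i x hx).hasDerivAt.pow 2)).div_const (2 * ((i : ℕ) : ℝ) + 3))).deriv
    have d2 := (((du.pow 2).div_const 2).add ((dh.add (hZd x hx).hasDerivAt).const_mul g)).add
      ((HasDerivAt.fun_sum (u := Finset.univ) fun i _ =>
        ((hαd i x hx).hasDerivAt.pow 2).div_const (2 * ((i : ℕ) : ℝ) + 3)).const_mul (3 / 2))
      |>.sub (hPd x hx).hasDerivAt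
    simp only [Pi.mul_def, Pi.add_def, Pi.pow_def, Pi.sub_def] at d1 d2
    rw [d1] at e
    refine d2.congr_deriv ?_
    rw [hP x hx]
    have hsum : ∑ i : Fin N, (deriv h x * α i x ^ 2
          + h x * (((2 : ℕ) : ℝ) * α i x ^ (2 - 1) * deriv (α i) x)) / (2 * ((i : ℕ) : ℝ) + 3)
        = h x * (3 / 2 * ∑ i : Fin N, ((2 : ℕ) : ℝ) * α i x ^ (2 - 1) * deriv (α i) x
            / (2 * ((i : ℕ) : ℝ) + 3)
          - ∑ i : Fin N, frictionP ν lam h u α i x * α i x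
            / ((2 * ((i : ℕ) : ℝ) + 3) * h x * u x)) := by
      rw [Finset.mul_sum, ← Finset.sum_sub_distrib, Finset.mul_sum]
      refine Finset.sum_congr rfl fun i _ => ?_
      rw [← hαeq i x hx]
      have := hc i
      field_simp
      push_cast
      ring
    rw [hsum] at e
    apply mul_left_cancel₀ hh
    have hP0 : h x * (frictionP0 ν lam u α x / h x) = frictionP0 ν lam u α x := by field_simp
    push_cast at e ⊢
    linear_combination e - u x * hcont x hx - hP0
  · refine exists_const_of_hasDerivAt_zero hI hIconn fun x hx => ?_
    have hh := (hpos x hx).ne'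
    have hu := hune x hx
    have d := ((hαd i x hx).hasDerivAt.div (hhd x hx).hasDerivAt hh).sub (hPid i x hx).hasDerivAt
    refine d.congr_deriv ?_
    rw [hPi i x hx, ← hαeq i x hx]
    field_simp
    ring
end

section
/- Assume ν = 0, so that P_0 ≡ 0 and P_i ≡ 0 for all i. Then (h, u, α_1, …, α_N) satisfies the HSWLME steady-state equations on I if and only if the functions hu, u²/2 + g(h+Z) + (3/2) Σ_{i=1}^N α_i²/(2i+1), and α_i/h (for each i = 1,…,N) are all constant on I. -/
/-- On an open convex set, a differentiable function is constant iff its derivative vanishes. -/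
theorem exists_eq_const_iff_hasDerivAt_eq_zero {I : Set ℝ} (hI : IsOpen I) (hIconv : Convex ℝ I)
    {f f' : ℝ → ℝ} (hf : ∀ x ∈ I, HasDerivAt f (f' x) x) :
    (∃ c : ℝ, ∀ x ∈ I, f x = c) ↔ ∀ x ∈ I, f' x = 0 := by
  constructor
  · rintro ⟨c, hc⟩ x hx
    have hev : f =ᶠ[nhds x] fun _ => c := Filter.eventually_of_mem (hI.mem_nhds hx) hc
    exact (hf x hx).unique ((hasDerivAt_const x c).congr_of_eventuallyEq hev)
  · intro hzero
    exact hI.exists_is_const_of_deriv_eq_zero hIconv.isPreconnected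
      (fun x hx => (hf x hx).differentiableAt.differentiableWithinAt)
      (fun x hx => (hf x hx).deriv.trans (hzero x hx))

/-- For constant discharge, the frictionless moment equation says that `α / h` is stationary. -/
theorem moment_balance_iff {h u a h' u' a' : ℝ} (hh : 0 < h) (hu : u ≠ 0)
    (hmass : h' * u + h * u' = 0) :
    2 * (h' * u + h * u') * a + 2 * (h * u) * a' = u * (h' * a + h * a') ↔
      (a' * h - a * h') / h ^ 2 = 0 := by
  rw [hmass, div_eq_zero_iff, or_iff_left (pow_ne_zero 2 hh.ne')]
  constructor
  · intro H
    apply mul_left_cancel₀ hu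
    linear_combination H
  · intro H
    linear_combination u * H

/-- For constant discharge and stationary `α i / h`, the frictionless momentum equation says that
the total head is stationary. -/
theorem momentum_balance_iff {ι : Type*} [Fintype ι] {g h u h' u' Z' : ℝ} {a a' w : ι → ℝ}
    (hh : 0 < h) (hmass : h' * u + h * u' = 0) (hmoment : ∀ i, a' i * h - a i * h' = 0) :
    h' * u ^ 2 + h * (2 * u * u') + g / 2 * (2 * h * h')
        + ∑ i, (h' * a i ^ 2 + h * (2 * a i * a' i)) / w i = -(g * h * Z') ↔
      2 * u * u' / 2 + g * (h' + Z') + 3 / 2 * ∑ i, 2 * a i * a' i / w i = 0 := by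
  have hsum : ∑ i, (h' * a i ^ 2 + h * (2 * a i * a' i)) / w i
      = h * (3 / 2 * ∑ i, 2 * a i * a' i / w i) := by
    simp only [Finset.mul_sum]
    refine Finset.sum_congr rfl fun i _ => ?_
    linear_combination -(a i / w i) * hmoment i
  rw [hsum]
  constructor
  · intro H
    apply mul_left_cancel₀ hh.ne'
    linear_combination H - u * hmass
  · intro H
    linear_combination h * H + u * hmass

/-- In the frictionless case `ν = 0`, `(h,u,α)` satisfies the HSWLME steady-state equations
on the open interval `I` if and only if `hu`, `u²/2 + g(h+Z) + (3/2)Σ α_i²/(2i+1)`, and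
`α_i/h` (for each `i`) are all constant on `I`. -/
theorem frictionless_steadyState_iff_constant_equilibrium_vars {N : ℕ} (hN : 1 ≤ N)
    (g ν lam : ℝ) (hg : 0 < g) (hν : 0 ≤ ν) (hlam : 0 < lam) (hν0 : ν = 0)
    (I : Set ℝ) (hI : IsOpen I) (hIconn : Convex ℝ I)
    (h u Z : ℝ → ℝ) (α : Fin N → ℝ → ℝ)
    (hhd : ∀ x ∈ I, DifferentiableAt ℝ h x)
    (hud : ∀ x ∈ I, DifferentiableAt ℝ u x)
    (hZd : ∀ x ∈ I, DifferentiableAt ℝ Z x)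
    (hαd : ∀ i : Fin N, ∀ x ∈ I, DifferentiableAt ℝ (α i) x)
    (hpos : ∀ x ∈ I, 0 < h x) (hune : ∀ x ∈ I, u x ≠ 0) :
    IsSteadyState g ν lam I h u Z α ↔
      ((∃ c : ℝ, ∀ x ∈ I, h x * u x = c) ∧
       (∃ c : ℝ, ∀ x ∈ I, (u x) ^ 2 / 2 + g * (h x + Z x)
           + 3 / 2 * ∑ i : Fin N, (α i x) ^ 2 / (2 * ((i : ℕ) : ℝ) + 3) = c) ∧
       (∀ i : Fin N, ∃ c : ℝ, ∀ x ∈ I, α i x / h x = c)) := by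
  subst hν0
  have hh x (hx : x ∈ I) := (hhd x hx).hasDerivAt
  have hu x (hx : x ∈ I) := (hud x hx).hasDerivAt
  have hZ x (hx : x ∈ I) := (hZd x hx).hasDerivAt
  have hα i x (hx : x ∈ I) := (hαd i x hx).hasDerivAt
  have hsq {f : ℝ → ℝ} {f' x : ℝ} (hf : HasDerivAt f f' x) :
      HasDerivAt (fun y => f y ^ 2) (2 * f x * f') x := by
    simpa using hf.fun_pow 2
  have hmassD x (hx : x ∈ I) : HasDerivAt (fun y => h y * u y)
      (deriv h x * u x + h x * deriv u x) x := (hh x hx).mul (hu x hx)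
  have hmomentumD x (hx : x ∈ I) : HasDerivAt (fun y => h y * (u y) ^ 2 + g / 2 * (h y) ^ 2
      + ∑ i : Fin N, h y * (α i y) ^ 2 / (2 * ((i : ℕ) : ℝ) + 3))
      (deriv h x * u x ^ 2 + h x * (2 * u x * deriv u x) + g / 2 * (2 * h x * deriv h x)
        + ∑ i : Fin N, (deriv h x * α i x ^ 2 + h x * (2 * α i x * deriv (α i) x))
          / (2 * ((i : ℕ) : ℝ) + 3)) x :=
    (((hh x hx).mul (hsq (hu x hx))).add ((hsq (hh x hx)).const_mul (g / 2))).add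
      (HasDerivAt.fun_sum fun i _ => ((hh x hx).mul (hsq (hα i x hx))).div_const _)
  have hmomentD i x (hx : x ∈ I) : HasDerivAt (fun y => 2 * h y * u y * α i y)
      (2 * (deriv h x * u x + h x * deriv u x) * α i x + 2 * (h x * u x) * deriv (α i) x) x := by
    simpa only [mul_assoc] using ((hmassD x hx).const_mul 2).fun_mul (hα i x hx)
  have hfluxD i x (hx : x ∈ I) : HasDerivAt (fun y => h y * α i y)
      (deriv h x * α i x + h x * deriv (α i) x) x := (hh x hx).mul (hα i x hx)
  have hheadD x (hx : x ∈ I) : HasDerivAt (fun x => (u x) ^ 2 / 2 + g * (h x + Z x)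
      + 3 / 2 * ∑ i : Fin N, (α i x) ^ 2 / (2 * ((i : ℕ) : ℝ) + 3))
      (2 * u x * deriv u x / 2 + g * (deriv h x + deriv Z x)
        + 3 / 2 * ∑ i : Fin N, 2 * α i x * deriv (α i) x / (2 * ((i : ℕ) : ℝ) + 3)) x :=
    (((hsq (hu x hx)).div_const 2).add (((hh x hx).add (hZ x hx)).const_mul g)).add
      ((HasDerivAt.fun_sum fun i _ => (hsq (hα i x hx)).div_const _).const_mul (3 / 2))
  have hratioD i x (hx : x ∈ I) : HasDerivAt (fun y => α i y / h y)
      ((deriv (α i) x * h x - α i x * deriv h x) / h x ^ 2) x :=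
    (hα i x hx).div (hh x hx) (hpos x hx).ne'
  rw [exists_eq_const_iff_hasDerivAt_eq_zero hI hIconn hmassD,
    exists_eq_const_iff_hasDerivAt_eq_zero hI hIconn hheadD,
    forall_congr' fun i => exists_eq_const_iff_hasDerivAt_eq_zero hI hIconn (hratioD i)]
  have hP0 x : frictionP0 0 lam u α x = 0 := by simp [frictionP0]
  have hP i x : frictionP 0 lam h u α i x = 0 := by simp [frictionP]
  unfold IsSteadyState
  simp only [hP0, hP, add_zero]
  refine (and_congr_left' (forall₂_congr fun x hx => by rw [(hmassD x hx).deriv])).trans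
    (and_congr_right fun hmass => ?_)
  refine (and_congr_right' (forall_congr' fun i => forall₂_congr fun x hx => by
    rw [(hmomentD i x hx).deriv, (hfluxD i x hx).deriv]
    exact moment_balance_iff (hpos x hx) (hune x hx) (hmass x hx))).trans
    (and_congr_left fun hratio => forall₂_congr fun x hx => ?_)
  rw [(hmomentumD x hx).deriv]
  refine momentum_balance_iff (hpos x hx) (hmass x hx) fun i => ?_
  exact (div_eq_zero_iff.mp (hratio i x hx)).resolve_right (pow_ne_zero 2 (hpos x hx).ne')
end

section
/- If (h, u, α_1, …, α_N) satisfies the HSWLME steady-state equations on I, then for every x ∈ I: (u²/2 + g(h+Z) + (3/2) Σ_{i=1}^N α_i²/(2i+1))'(x) = P_0(x)/h(x) + Σ_{i=1}^N P_i(x) α_i(x)/((2i+1) h(x) u(x)), and (α_i/h)'(x) = P_i(x)/(h(x)² u(x)) for each i = 1,…,N. -/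
/-- If `h u` is stationary at `x`, the balance law `(2 h u a)' = u (h a)' + p` amounts to
`h u a' = u h' a + p` at `x`. -/
lemma mul_deriv_eq_of_moment_balance {h u a : ℝ → ℝ} {x h' u' a' p : ℝ}
    (hh : HasDerivAt h h' x) (hu : HasDerivAt u u' x) (ha : HasDerivAt a a' x)
    (hmass : h' * u x + h x * u' = 0)
    (hbal : deriv (fun y => 2 * h y * u y * a y) x = u x * deriv (fun y => h y * a y) x + p) :
    h x * u x * a' = u x * h' * a x + p := by
  have hl : deriv (fun y => 2 * h y * u y * a y) x = _ :=
    (((hh.const_mul 2).mul hu).mul ha).deriv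
  have hr : deriv (fun y => h y * a y) x = _ := (hh.mul ha).deriv
  rw [hl, hr] at hbal
  simp only [Pi.mul_apply] at hbal
  linear_combination hbal - 2 * a x * hmass

/-- If `(h,u,α)` satisfies the HSWLME steady-state equations on `I`, then for every `x ∈ I`:
`(u²/2 + g(h+Z) + (3/2)Σ α_i²/(2i+1))' = P_0/h + Σ P_i α_i/((2i+1) h u)` and
`(α_i/h)' = P_i/(h² u)` for each `i`. -/
theorem steadyState_derivative_identities {N : ℕ} (hN : 1 ≤ N)
    (g ν lam : ℝ) (hg : 0 < g) (hν : 0 ≤ ν) (hlam : 0 < lam)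
    (I : Set ℝ) (hI : IsOpen I) (hIconn : Convex ℝ I)
    (h u Z : ℝ → ℝ) (α : Fin N → ℝ → ℝ)
    (hhd : ∀ x ∈ I, DifferentiableAt ℝ h x)
    (hud : ∀ x ∈ I, DifferentiableAt ℝ u x)
    (hZd : ∀ x ∈ I, DifferentiableAt ℝ Z x)
    (hαd : ∀ i : Fin N, ∀ x ∈ I, DifferentiableAt ℝ (α i) x)
    (hpos : ∀ x ∈ I, 0 < h x) (hune : ∀ x ∈ I, u x ≠ 0)
    (hss : IsSteadyState g ν lam I h u Z α) :
    ∀ x ∈ I,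
      (deriv (fun y => (u y) ^ 2 / 2 + g * (h y + Z y)
          + 3 / 2 * ∑ i : Fin N, (α i y) ^ 2 / (2 * ((i : ℕ) : ℝ) + 3)) x
        = frictionP0 ν lam u α x / h x
          + ∑ i : Fin N, frictionP ν lam h u α i x * α i x
              / ((2 * ((i : ℕ) : ℝ) + 3) * h x * u x)) ∧
      (∀ i : Fin N, deriv (fun y => α i y / h y) x
        = frictionP ν lam h u α i x / ((h x) ^ 2 * u x)) := by
  intro x hx
  obtain ⟨hmass, hmom, hbal⟩ := hss
  have hh := (hhd x hx).hasDerivAt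
  have hu := (hud x hx).hasDerivAt
  have hZ := (hZd x hx).hasDerivAt
  have hα := fun i => (hαd i x hx).hasDerivAt
  have hh0 : h x ≠ 0 := (hpos x hx).ne'
  have hu0 : u x ≠ 0 := hune x hx
  have hmass' : deriv h x * u x + h x * deriv u x = 0 :=
    (hh.mul hu).deriv.symm.trans (hmass x hx)
  have hbal' : ∀ i, h x * u x * deriv (α i) x
      = u x * deriv h x * α i x + frictionP ν lam h u α i x := fun i =>
    mul_deriv_eq_of_moment_balance hh hu (hα i) hmass' (hbal i x hx)
  refine ⟨?_, fun i => ?_⟩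
  · have hmom' := hmom x hx
    have hflux := (((hh.mul (hu.pow 2)).add ((hh.pow 2).const_mul (g / 2))).add
      (HasDerivAt.fun_sum (u := Finset.univ) fun i _ =>
        (hh.mul ((hα i).pow 2)).div_const (2 * ((i : ℕ) : ℝ) + 3))).deriv
    have hhead := ((((hu.pow 2).div_const 2).add ((hh.add hZ).const_mul g)).add
      ((HasDerivAt.fun_sum (u := Finset.univ) fun i _ =>
        ((hα i).pow 2).div_const (2 * ((i : ℕ) : ℝ) + 3)).const_mul (3 / 2))).deriv
    have hmom'' := hflux.symm.trans hmom'
    refine hhead.trans ?_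
    simp only [Pi.pow_apply, Nat.cast_ofNat, Nat.add_one_sub_one, pow_one] at hmom'' ⊢
    have hterm : h x * (3 / 2 * ∑ i : Fin N, 2 * α i x * deriv (α i) x
          / (2 * ((i : ℕ) : ℝ) + 3))
        = ∑ i : Fin N, (deriv h x * α i x ^ 2 + h x * (2 * α i x * deriv (α i) x))
          / (2 * ((i : ℕ) : ℝ) + 3)
        + h x * ∑ i : Fin N, frictionP ν lam h u α i x * α i x
              / ((2 * ((i : ℕ) : ℝ) + 3) * h x * u x) := by
      simp only [Finset.mul_sum, ← Finset.sum_add_distrib]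
      refine Finset.sum_congr rfl fun i _ => ?_
      have hc : 2 * ((i : ℕ) : ℝ) + 3 ≠ 0 := by positivity
      field_simp
      linear_combination α i x * hbal' i
    apply mul_left_cancel₀ hh0
    rw [mul_add (h x) (frictionP0 ν lam u α x / h x), mul_div_cancel₀ _ hh0]
    linear_combination hmom'' + hterm - u x * hmass'
  · refine ((hα i).div hh hh0).deriv.trans ?_
    field_simp
    linear_combination hbal' i
end

section
/- The characteristic polynomial of A equals (X − u)^N · ((X − u)² − (g h + 3 Σ_{i=1}^N α_i²/(2i+1))). -/
/-- The `(N+2)×(N+2)` HSWLME system matrix `A = ∂F/∂U - Q` in conservative variables: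
row 0 is `(0,1,0,…,0)`; row 1 is
`(g h - u² - Σ α_i²/(2i+1), 2u, 2α_1/3, …, 2α_N/(2N+1))`; for `i = 1,…,N`, row `i+1`
has `-2uα_i` in column 0, `2α_i` in column 1, `u` in column `i+1`, and zeros elsewhere. -/
noncomputable def Amat (N : ℕ) (g h u : ℝ) (α : Fin N → ℝ) :
    Matrix (Fin (N + 2)) (Fin (N + 2)) ℝ :=
  Matrix.of fun r c =>
    if (r : ℕ) = 0 then (if (c : ℕ) = 1 then 1 else 0)
    else if (r : ℕ) = 1 then
      if (c : ℕ) = 0 then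
        g * h - u ^ 2 - ∑ i : Fin N, (α i) ^ 2 / (2 * ((i : ℕ) : ℝ) + 3)
      else if (c : ℕ) = 1 then 2 * u
      else if hc : 2 ≤ (c : ℕ) then
        2 * α ⟨(c : ℕ) - 2, by have := c.isLt; omega⟩
          / (2 * ((((c : ℕ) - 2 : ℕ)) : ℝ) + 3)
      else 0
    else if hr : 2 ≤ (r : ℕ) then
      if (c : ℕ) = 0 then -2 * u * α ⟨(r : ℕ) - 2, by have := r.isLt; omega⟩
      else if (c : ℕ) = 1 then 2 * α ⟨(r : ℕ) - 2, by have := r.isLt; omega⟩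
      else if c = r then u
      else 0
    else 0

/-- A division-free Schur complement formula for a block matrix with scalar lower right block. -/
theorem Matrix.det_fromBlocks_smul_one_mul_pow {R m n : Type*} [CommRing R] [Fintype m]
    [DecidableEq m] [Fintype n] [DecidableEq n] (P : Matrix m m R) (B : Matrix m n R)
    (C : Matrix n m R) (d : R) :
    (Matrix.fromBlocks P B C (d • 1)).det * d ^ Fintype.card m
      = (d • P - B * C).det * d ^ Fintype.card n := by
  have key : Matrix.fromBlocks P B C (d • 1) * Matrix.fromBlocks (d • 1) 0 (-C) 1
      = Matrix.fromBlocks (d • P - B * C) B 0 (d • 1) := by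
    simp [Matrix.fromBlocks_multiply, sub_eq_add_neg]
  simpa using congrArg Matrix.det key

/-- Splits the indices of `Amat` into the two shallow water indices and the `N` moment indices. -/
def blockEquiv (N : ℕ) : Fin 2 ⊕ Fin N ≃ Fin (N + 2) :=
  finSumFinEquiv.trans (finCongr (Nat.add_comm 2 N))

@[simp]
theorem blockEquiv_inl_val {N : ℕ} (i : Fin 2) : (blockEquiv N (Sum.inl i) : ℕ) = i := by
  simp [blockEquiv]

@[simp]
theorem blockEquiv_inr_val {N : ℕ} (i : Fin N) : (blockEquiv N (Sum.inr i) : ℕ) = i + 2 := by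
  simp [blockEquiv]

theorem Amat_submatrix_blockEquiv (N : ℕ) (g h u : ℝ) (α : Fin N → ℝ) :
    (Amat N g h u α).submatrix (blockEquiv N) (blockEquiv N)
      = Matrix.fromBlocks
          !![0, 1; g * h - u ^ 2 - ∑ i : Fin N, (α i) ^ 2 / (2 * ((i : ℕ) : ℝ) + 3), 2 * u]
          (Matrix.of ![0, fun i => 2 * α i / (2 * ((i : ℕ) : ℝ) + 3)])
          (Matrix.of fun i => ![-2 * u * α i, 2 * α i])
          (u • 1) := by
  ext r c
  rcases r with r | r <;> rcases c with c | c
  · fin_cases r <;> fin_cases c <;> simp [Amat, -Fin.val_eq_zero_iff]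
  · fin_cases r <;> simp [Amat, -Fin.val_eq_zero_iff]
  · fin_cases c <;> simp [Amat, -Fin.val_eq_zero_iff]
  · simp [Amat, Matrix.one_apply, eq_comm (a := r), -Fin.val_eq_zero_iff]

open Polynomial in
/-- The characteristic polynomial of `A` is `(X-u)^N ((X-u)² - (gh + 3Σ α_i²/(2i+1)))`. -/
theorem charpoly_Amat {N : ℕ} (hN : 1 ≤ N) (g h u : ℝ) (α : Fin N → ℝ) :
    (Amat N g h u α).charpoly
      = (X - C u) ^ N *
        ((X - C u) ^ 2
          - C (g * h + 3 * ∑ i : Fin N, (α i) ^ 2 / (2 * ((i : ℕ) : ℝ) + 3))) := by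
  set s := ∑ i : Fin N, (α i) ^ 2 / (2 * ((i : ℕ) : ℝ) + 3) with hs
  have hd : (X - C u : ℝ[X]) ≠ 0 := X_sub_C_ne_zero u
  have hsum : ∑ i : Fin N, C (2 * α i / (2 * ((i : ℕ) : ℝ) + 3)) * C (α i) = C (2 * s) := by
    simp only [← C_mul, ← map_sum, hs, Finset.mul_sum]
    exact congrArg C (Finset.sum_congr rfl fun i _ => by ring)
  let P : Matrix (Fin 2) (Fin 2) ℝ[X] := !![X, -1; -C (g * h - u ^ 2 - s), X - C (2 * u)]
  let B : Matrix (Fin 2) (Fin N) ℝ[X] :=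
    Matrix.of ![0, fun i => -C (2 * α i / (2 * ((i : ℕ) : ℝ) + 3))]
  let K : Matrix (Fin N) (Fin 2) ℝ[X] := Matrix.of fun i => ![C (2 * u) * C (α i), -C 2 * C (α i)]
  have hblock : (Amat N g h u α).charpoly
      = (Matrix.fromBlocks P B K ((X - C u) • 1)).det := by
    rw [← Matrix.charpoly_reindex (blockEquiv N).symm, Matrix.reindex_apply, Equiv.symm_symm,
      Amat_submatrix_blockEquiv, Matrix.charpoly, Matrix.charmatrix_fromBlocks]
    congr 2
    · ext1 i j
      fin_cases i <;> fin_cases j <;> simp [P, Matrix.charmatrix, hs]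
    · ext1 i j
      fin_cases i <;> simp [B]
    · ext1 i j
      fin_cases j <;> simp [K]
    · ext1 i j
      by_cases hij : i = j <;> simp [Matrix.charmatrix, hij]
  have hBK : B * K = !![0, 0; -C (2 * u) * C (2 * s), C 2 * C (2 * s)] := by
    ext1 i j
    fin_cases i <;> fin_cases j <;>
      simp only [B, K, Matrix.mul_apply, ← hsum, Finset.mul_sum] <;> simp
    all_goals exact Finset.sum_congr rfl fun i _ => by ring
  have hschur := Matrix.det_fromBlocks_smul_one_mul_pow P B K (X - C u)
  rw [hBK, Fintype.card_fin, Fintype.card_fin] at hschur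
  rw [hblock]
  refine mul_right_cancel₀ (pow_ne_zero 2 hd) (hschur.trans ?_)
  simp only [P, Matrix.det_fin_two, Matrix.sub_apply, Matrix.smul_apply, Matrix.of_apply,
    Matrix.cons_val_zero, Matrix.cons_val_one, Matrix.cons_val', smul_eq_mul]
  simp only [C_sub, C_add, C_mul, C_pow]
  simp only [show (C 2 : ℝ[X]) = 2 from rfl, show (C 3 : ℝ[X]) = 3 from rfl]
  ring
end

section
/- If g ≥ 0 and h ≥ 0, then every complex eigenvalue of A is real, and the set of eigenvalues of A is {u, u − c, u + c}, where c := sqrt(g h + 3 Σ_{i=1}^N α_i²/(2i+1)). -/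
open scoped Matrix in
/-- Over a field, the spectrum of a matrix consists of its eigenvalues. -/
theorem Matrix.mem_spectrum_iff_exists_mulVec_eq_smul {n K : Type*} [Fintype n] [DecidableEq n]
    [Field K] (M : Matrix n n K) (z : K) :
    z ∈ spectrum K M ↔ ∃ v ≠ 0, M *ᵥ v = z • v := by
  rw [spectrum.mem_iff, Matrix.isUnit_iff_isUnit_det, isUnit_iff_ne_zero, not_not,
    ← Matrix.exists_mulVec_eq_zero_iff]
  refine exists_congr fun v => and_congr_right fun _ => ?_
  rw [Matrix.sub_mulVec, sub_eq_zero, Algebra.algebraMap_eq_smul_one, Matrix.smul_mulVec,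
    Matrix.one_mulVec, eq_comm]

section Eigenvalues

open scoped Matrix

variable {N : ℕ} (g h u : ℝ) (α : Fin N → ℝ) {K : Type*} [Field K] [Algebra ℝ K]

theorem Amat_map_mulVec_zero (v : Fin (N + 2) → K) :
    ((Amat N g h u α).map (algebraMap ℝ K) *ᵥ v) 0 = v 1 := by
  simp [Matrix.mulVec, dotProduct, Fin.sum_univ_succ, Amat]

theorem Amat_map_mulVec_one (v : Fin (N + 2) → K) :
    ((Amat N g h u α).map (algebraMap ℝ K) *ᵥ v) 1 =
      algebraMap ℝ K (g * h - u ^ 2 - ∑ i : Fin N, (α i) ^ 2 / (2 * ((i : ℕ) : ℝ) + 3)) * v 0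
        + algebraMap ℝ K (2 * u) * v 1
        + ∑ i : Fin N, algebraMap ℝ K (2 * α i / (2 * ((i : ℕ) : ℝ) + 3)) * v i.succ.succ := by
  simp [Matrix.mulVec, dotProduct, Fin.sum_univ_succ, Amat, add_assoc]

theorem Amat_map_mulVec_succ_succ (v : Fin (N + 2) → K) (i : Fin N) :
    ((Amat N g h u α).map (algebraMap ℝ K) *ᵥ v) i.succ.succ =
      algebraMap ℝ K (-2 * u * α i) * v 0 + algebraMap ℝ K (2 * α i) * v 1
        + algebraMap ℝ K u * v i.succ.succ := by
  simp [Matrix.mulVec, dotProduct, Fin.sum_univ_succ, Amat, add_assoc, apply_ite (algebraMap ℝ K)]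

theorem Amat_map_mulVec_eq_smul_iff (v : Fin (N + 2) → K) (z : K) :
    (Amat N g h u α).map (algebraMap ℝ K) *ᵥ v = z • v ↔
      v 1 = z * v 0 ∧
      algebraMap ℝ K (g * h - u ^ 2 - ∑ i : Fin N, (α i) ^ 2 / (2 * ((i : ℕ) : ℝ) + 3)) * v 0
        + algebraMap ℝ K (2 * u) * v 1
        + ∑ i : Fin N, algebraMap ℝ K (2 * α i / (2 * ((i : ℕ) : ℝ) + 3)) * v i.succ.succ
        = z * v 1 ∧
      ∀ i : Fin N, algebraMap ℝ K (-2 * u * α i) * v 0 + algebraMap ℝ K (2 * α i) * v 1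
        + algebraMap ℝ K u * v i.succ.succ = z * v i.succ.succ := by
  rw [funext_iff, Fin.forall_fin_succ, Fin.forall_fin_succ]
  simp only [Fin.succ_zero_eq_one, Amat_map_mulVec_zero, Amat_map_mulVec_one,
    Amat_map_mulVec_succ_succ, Pi.smul_apply, smul_eq_mul]

theorem sum_coupling_mul_two_mul (a : K) :
    ∑ i : Fin N, algebraMap ℝ K (2 * α i / (2 * ((i : ℕ) : ℝ) + 3))
        * (algebraMap ℝ K (2 * α i) * a) =
      algebraMap ℝ K (4 * ∑ i : Fin N, (α i) ^ 2 / (2 * ((i : ℕ) : ℝ) + 3)) * a := by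
  rw [Finset.mul_sum, map_sum, Finset.sum_mul]
  refine Finset.sum_congr rfl fun i _ => ?_
  rw [← mul_assoc, ← map_mul]
  congr 2
  ring

/-- The eigenvector of `Amat` for the eigenvalue `u` uses only one of the coefficients `α i`. -/
theorem mem_spectrum_Amat_map_self (hN : 1 ≤ N) :
    algebraMap ℝ K u ∈ spectrum K ((Amat N g h u α).map (algebraMap ℝ K)) := by
  rw [Matrix.mem_spectrum_iff_exists_mulVec_eq_smul]
  obtain ⟨a, b, hab, hne⟩ : ∃ a b : K,
      algebraMap ℝ K (g * h - ∑ i : Fin N, (α i) ^ 2 / (2 * ((i : ℕ) : ℝ) + 3)) * a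
        + algebraMap ℝ K (2 * α ⟨0, hN⟩ / (2 * ((0 : ℕ) : ℝ) + 3)) * b = 0 ∧ (a ≠ 0 ∨ b ≠ 0) := by
    generalize algebraMap ℝ K (g * h - ∑ i : Fin N, (α i) ^ 2 / (2 * ((i : ℕ) : ℝ) + 3)) = p
    generalize algebraMap ℝ K (2 * α ⟨0, hN⟩ / (2 * ((0 : ℕ) : ℝ) + 3)) = q
    by_cases hq : q = 0
    · exact ⟨0, 1, by simp [hq], Or.inr one_ne_zero⟩
    · exact ⟨q, -p, by ring, Or.inl hq⟩
  refine ⟨Fin.cons a (Fin.cons (algebraMap ℝ K u * a) (Pi.single ⟨0, hN⟩ b)), ?_, ?_⟩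
  · intro hv
    have h0 := congrFun hv 0
    have h2 := congrFun hv (Fin.succ (Fin.succ ⟨0, hN⟩))
    simp only [Fin.cons_zero, Fin.cons_succ, Pi.single_eq_same, Pi.zero_apply] at h0 h2
    exact hne.elim (fun ha => ha h0) (fun hb => hb h2)
  · rw [Amat_map_mulVec_eq_smul_iff, ← Fin.succ_zero_eq_one]
    simp only [Fin.cons_zero, Fin.cons_succ]
    refine ⟨trivial, ?_, fun i => ?_⟩
    · have hsum : ∑ i : Fin N, algebraMap ℝ K (2 * α i / (2 * ((i : ℕ) : ℝ) + 3))
            * (Pi.single ⟨0, hN⟩ b : Fin N → K) i =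
          algebraMap ℝ K (2 * α ⟨0, hN⟩ / (2 * ((0 : ℕ) : ℝ) + 3)) * b := by
        simp [Pi.single_apply]
      rw [hsum]
      simp only [map_sub, map_mul, map_pow, map_ofNat] at hab ⊢
      linear_combination hab
    · simp only [map_mul, map_neg, map_ofNat]
      ring

theorem mem_spectrum_Amat_map_iff (hN : 1 ≤ N) {c : ℝ}
    (hc : c ^ 2 = g * h + 3 * ∑ i : Fin N, (α i) ^ 2 / (2 * ((i : ℕ) : ℝ) + 3)) (z : K) :
    z ∈ spectrum K ((Amat N g h u α).map (algebraMap ℝ K)) ↔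
      z = algebraMap ℝ K u ∨ z = algebraMap ℝ K (u - c) ∨ z = algebraMap ℝ K (u + c) := by
  by_cases hz : z = algebraMap ℝ K u
  · refine iff_of_true ?_ (Or.inl hz)
    rw [hz]
    exact mem_spectrum_Amat_map_self g h u α hN
  have hzu : z - algebraMap ℝ K u ≠ 0 := sub_ne_zero.mpr hz
  have hcK := congrArg (algebraMap ℝ K) hc
  simp only [map_add, map_mul, map_pow, map_ofNat] at hcK
  have hroots : (z = algebraMap ℝ K (u - c) ∨ z = algebraMap ℝ K (u + c)) ↔
      (z - algebraMap ℝ K u) ^ 2 = algebraMap ℝ K c ^ 2 := by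
    rw [sq_eq_sq_iff_eq_or_eq_neg, or_comm, map_add, map_sub]
    refine or_congr ?_ ?_ <;> constructor <;> intro H <;> linear_combination H
  simp only [hz, false_or]
  rw [hroots, Matrix.mem_spectrum_iff_exists_mulVec_eq_smul]
  constructor
  · rintro ⟨v, hv, hAv⟩
    obtain ⟨h1, h2, h3⟩ := (Amat_map_mulVec_eq_smul_iff g h u α v z).mp hAv
    have hvi (i : Fin N) : v i.succ.succ = algebraMap ℝ K (2 * α i) * v 0 := by
      apply mul_left_cancel₀ hzu
      have := h3 i
      simp only [map_mul, map_neg, map_ofNat, h1] at this ⊢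
      linear_combination -this
    have hv0 : v 0 ≠ 0 := by
      intro h0
      apply hv
      rw [funext_iff, Fin.forall_fin_succ, Fin.forall_fin_succ]
      simp [h1, hvi, h0]
    simp only [hvi, sum_coupling_mul_two_mul, h1] at h2
    simp only [map_sub, map_mul, map_pow, map_ofNat] at h2
    apply mul_right_cancel₀ hv0
    rw [hcK]
    linear_combination -h2
  · intro hsq
    refine ⟨Fin.cons 1 (Fin.cons z fun i => algebraMap ℝ K (2 * α i) * 1), ?_, ?_⟩
    · intro hv
      simpa using congrFun hv 0
    · rw [Amat_map_mulVec_eq_smul_iff, ← Fin.succ_zero_eq_one]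
      simp only [Fin.cons_zero, Fin.cons_succ, sum_coupling_mul_two_mul]
      refine ⟨(mul_one z).symm, ?_, fun i => ?_⟩
      · rw [hcK] at hsq
        simp only [map_sub, map_mul, map_pow, map_ofNat]
        linear_combination -hsq
      · simp only [map_mul, map_neg, map_ofNat]
        ring

end Eigenvalues

/-- If `g ≥ 0` and `h ≥ 0`, every complex eigenvalue of `A` is real, and the set of
(real) eigenvalues of `A` is `{u, u - c, u + c}` with
`c = sqrt(g h + 3 Σ α_i²/(2i+1))`. -/
theorem spectrum_Amat {N : ℕ} (hN : 1 ≤ N) (g h u : ℝ) (α : Fin N → ℝ)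
    (hg : 0 ≤ g) (hh : 0 ≤ h) :
    (∀ z ∈ spectrum ℂ ((Amat N g h u α).map (algebraMap ℝ ℂ)), z.im = 0) ∧
    spectrum ℝ (Amat N g h u α)
      = {u,
         u - Real.sqrt (g * h + 3 * ∑ i : Fin N, (α i) ^ 2 / (2 * ((i : ℕ) : ℝ) + 3)),
         u + Real.sqrt (g * h + 3 * ∑ i : Fin N, (α i) ^ 2 / (2 * ((i : ℕ) : ℝ) + 3))} := by
  have hc : Real.sqrt (g * h + 3 * ∑ i : Fin N, (α i) ^ 2 / (2 * ((i : ℕ) : ℝ) + 3)) ^ 2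
      = g * h + 3 * ∑ i : Fin N, (α i) ^ 2 / (2 * ((i : ℕ) : ℝ) + 3) :=
    Real.sq_sqrt (by positivity)
  constructor
  · intro z hz
    rcases (mem_spectrum_Amat_map_iff g h u α hN hc z).mp hz with rfl | rfl | rfl <;>
      exact Complex.ofReal_im _
  · ext z
    exact mem_spectrum_Amat_map_iff (K := ℝ) g h u α hN hc z
end

section
/- If λ ∈ ℝ satisfies (λ − u)² = g h + 3 Σ_{i=1}^N α_i²/(2i+1), then the vector v = (1, λ, 2α_1, …, 2α_N)ᵀ ∈ ℝ^{N+2} satisfies A v = λ v; in particular v is an eigenvector of A with eigenvalue λ. -/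
/-- If `(λ - u)² = g h + 3 Σ α_i²/(2i+1)`, then `v = (1, λ, 2α_1, …, 2α_N)ᵀ`
satisfies `A v = λ v`; in particular `v ≠ 0`, i.e. `v` is an eigenvector of `A`
with eigenvalue `λ`. -/
theorem eigenvector_Amat {N : ℕ} (hN : 1 ≤ N) (g h u lam : ℝ) (α : Fin N → ℝ)
    (hlam : (lam - u) ^ 2
      = g * h + 3 * ∑ i : Fin N, (α i) ^ 2 / (2 * ((i : ℕ) : ℝ) + 3))
    (v : Fin (N + 2) → ℝ)
    (hv0 : v 0 = 1) (hv1 : v 1 = lam)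
    (hvi : ∀ i : Fin N, v i.succ.succ = 2 * α i) :
    (Amat N g h u α).mulVec v = lam • v ∧ v ≠ 0 := by
  refine ⟨?_, fun hv => by simp [hv] at hv0⟩
  funext r
  rw [Matrix.mulVec, dotProduct, Fin.sum_univ_succ, Fin.sum_univ_succ, Pi.smul_apply, smul_eq_mul]
  simp only [Fin.succ_zero_eq_one, hv0, hv1, hvi]
  refine Fin.cases ?_ (fun r => Fin.cases ?_ (fun i => ?_) r) r
  · simp [Amat, hv0]
  · have hsum : ∑ i : Fin N, Amat N g h u α 1 i.succ.succ * (2 * α i)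
        = 4 * ∑ i : Fin N, (α i) ^ 2 / (2 * ((i : ℕ) : ℝ) + 3) := by
      rw [Finset.mul_sum]
      refine Finset.sum_congr rfl fun i _ => ?_
      simp [Amat]
      ring
    rw [Fin.succ_zero_eq_one, hsum, hv1]
    simp [Amat]
    linarith
  · have hsum : ∑ j : Fin N, Amat N g h u α i.succ.succ j.succ.succ * (2 * α j)
        = u * (2 * α i) := by
      rw [Finset.sum_eq_single i]
      · simp [Amat]
      · intro j _ hji
        simp [Amat, hji]
      · simp
    rw [hsum, hvi]
    simp [Amat]
    ring
end

section
/- Let g ≥ 0 and let (h⁻, u⁻, α⁻_1,…,α⁻_N) and (h⁺, u⁺, α⁺_1,…,α⁺_N) be two states with h⁻ ≥ 0 and h⁺ ≥ 0. Set c^± := sqrt(g h^± + 3 Σ_{i=1}^N (α_i^±)²/(2i+1)), a⁺ := max{u⁺ + c⁺, u⁻ + c⁻, 0}, and a⁻ := min{u⁺ − c⁺, u⁻ − c⁻, 0}. Then a⁻ ≤ 0 ≤ a⁺, and every real eigenvalue μ of A evaluated at either state satisfies a⁻ ≤ μ ≤ a⁺. -/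
theorem Amat_mulVec_zero {N : ℕ} (g h u : ℝ) (α : Fin N → ℝ) (v : Fin (N + 2) → ℝ) :
    (Amat N g h u α).mulVec v 0 = v 1 := by
  simp [Amat, Matrix.mulVec, dotProduct, Fin.sum_univ_succ]

theorem Amat_mulVec_one {N : ℕ} (g h u : ℝ) (α : Fin N → ℝ) (v : Fin (N + 2) → ℝ) :
    (Amat N g h u α).mulVec v 1 =
      (g * h - u ^ 2 - ∑ i : Fin N, (α i) ^ 2 / (2 * ((i : ℕ) : ℝ) + 3)) * v 0 + 2 * u * v 1 +
        ∑ i : Fin N, 2 * α i / (2 * ((i : ℕ) : ℝ) + 3) * v i.succ.succ := by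
  simp [Amat, Matrix.mulVec, dotProduct, Fin.sum_univ_succ, add_assoc]

theorem Amat_mulVec_succ_succ {N : ℕ} (g h u : ℝ) (α : Fin N → ℝ) (v : Fin (N + 2) → ℝ)
    (i : Fin N) :
    (Amat N g h u α).mulVec v i.succ.succ =
      -2 * u * α i * v 0 + 2 * α i * v 1 + u * v i.succ.succ := by
  simp [Amat, Matrix.mulVec, dotProduct, Fin.sum_univ_succ, add_assoc]

/-- Every real eigenvalue of `Amat` other than `u` is one of `u ± √(g h + 3 Σ α_i²/(2i+1))`. -/
theorem sq_sub_eq_of_mem_spectrum_Amat {N : ℕ} {g h u μ : ℝ} {α : Fin N → ℝ}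
    (hμ : μ ∈ spectrum ℝ (Amat N g h u α)) (hne : μ ≠ u) :
    (μ - u) ^ 2 = g * h + 3 * ∑ i : Fin N, (α i) ^ 2 / (2 * ((i : ℕ) : ℝ) + 3) := by
  rw [← Matrix.spectrum_toLin', ← Module.End.hasEigenvalue_iff_mem_spectrum] at hμ
  obtain ⟨v, hv⟩ := hμ.exists_hasEigenvector
  have hAv : (Amat N g h u α).mulVec v = μ • v := hv.apply_eq_smul
  have h0 : v 1 = μ * v 0 := by simpa [Amat_mulVec_zero] using congrFun hAv 0
  have h1 := congrFun hAv 1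
  have hs (i : Fin N) : v i.succ.succ = 2 * α i * v 0 := by
    have := congrFun hAv i.succ.succ
    rw [Amat_mulVec_succ_succ, Pi.smul_apply, smul_eq_mul] at this
    apply mul_left_cancel₀ (sub_ne_zero.mpr hne)
    linear_combination -this + 2 * α i * h0
  have hv0 : v 0 ≠ 0 := by
    intro hz
    refine hv.2 (funext fun j => ?_)
    refine Fin.cases hz (fun j => ?_) j
    match N, j with
    | _, ⟨0, _⟩ => exact h0.trans (by simp [hz])
    | _ + 1, ⟨k + 1, hk⟩ => exact (hs ⟨k, by omega⟩).trans (by simp [hz])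
  have hsum : ∑ i : Fin N, 2 * α i / (2 * ((i : ℕ) : ℝ) + 3) * v i.succ.succ =
      4 * (∑ i : Fin N, (α i) ^ 2 / (2 * ((i : ℕ) : ℝ) + 3)) * v 0 := by
    rw [Finset.mul_sum, Finset.sum_mul]
    refine Finset.sum_congr rfl fun i _ => ?_
    rw [hs]
    ring
  rw [Amat_mulVec_one, hsum, Pi.smul_apply, smul_eq_mul] at h1
  apply mul_right_cancel₀ hv0
  linear_combination -h1 + (2 * u - μ) * h0

theorem abs_sub_le_of_mem_spectrum_Amat {N : ℕ} {g h u μ : ℝ} {α : Fin N → ℝ}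
    (hμ : μ ∈ spectrum ℝ (Amat N g h u α)) :
    |μ - u| ≤ √(g * h + 3 * ∑ i : Fin N, (α i) ^ 2 / (2 * ((i : ℕ) : ℝ) + 3)) := by
  by_cases hne : μ = u
  · simp [hne]
  · exact Real.abs_le_sqrt (sq_sub_eq_of_mem_spectrum_Amat hμ hne).le

/-- For two states with `g ≥ 0`, `h^± ≥ 0`, the local one-sided speeds
`a⁺ = max{u⁺+c⁺, u⁻+c⁻, 0}` and `a⁻ = min{u⁺-c⁺, u⁻-c⁻, 0}` satisfy `a⁻ ≤ 0 ≤ a⁺`,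
and every real eigenvalue of `A` at either state lies in `[a⁻, a⁺]`. -/
theorem local_speeds_bound_spectrum {N : ℕ} (hN : 1 ≤ N) (g : ℝ) (hg : 0 ≤ g)
    (hm hp um up : ℝ) (αm αp : Fin N → ℝ) (hhm : 0 ≤ hm) (hhp : 0 ≤ hp)
    (cm cp aP aM : ℝ)
    (hcm : cm = Real.sqrt (g * hm + 3 * ∑ i : Fin N, (αm i) ^ 2 / (2 * ((i : ℕ) : ℝ) + 3)))
    (hcp : cp = Real.sqrt (g * hp + 3 * ∑ i : Fin N, (αp i) ^ 2 / (2 * ((i : ℕ) : ℝ) + 3)))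
    (haP : aP = max (max (up + cp) (um + cm)) 0)
    (haM : aM = min (min (up - cp) (um - cm)) 0) :
    aM ≤ 0 ∧ 0 ≤ aP ∧
    (∀ μ ∈ spectrum ℝ (Amat N g hm um αm), aM ≤ μ ∧ μ ≤ aP) ∧
    (∀ μ ∈ spectrum ℝ (Amat N g hp up αp), aM ≤ μ ∧ μ ≤ aP) := by
  subst haP haM
  refine ⟨min_le_right _ _, le_max_right _ _, fun μ hμ => ?_, fun μ hμ => ?_⟩
  · have hb := abs_le.mp (hcm ▸ abs_sub_le_of_mem_spectrum_Amat hμ)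
    exact ⟨((min_le_left _ _).trans (min_le_right _ _)).trans (by linarith),
      le_trans (by linarith) ((le_max_right _ _).trans (le_max_left _ _))⟩
  · have hb := abs_le.mp (hcp ▸ abs_sub_le_of_mem_spectrum_Amat hμ)
    exact ⟨((min_le_left _ _).trans (min_le_left _ _)).trans (by linarith),
      le_trans (by linarith) ((le_max_left _ _).trans (le_max_left _ _))⟩
end

section
/- If g > 0 and h > 0, then A is diagonalizable over ℝ: there exist an invertible real (N+2)×(N+2) matrix T and a diagonal real matrix D such that A = T D T⁻¹. -/
/-- The matrix whose columns are eigenvectors of `Amat` for the eigenvalues `u + s`, `u - s` and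
`u` (the latter repeated `N` times), where `p` collects the first components of the eigenvectors
for `u`. -/
def eigenvectorMatrix {N : ℕ} (u s : ℝ) (α p : Fin N → ℝ) :
    Matrix (Fin (N + 2)) (Fin (N + 2)) ℝ :=
  Matrix.of <| Matrix.vecCons (Matrix.vecCons 1 (Matrix.vecCons 1 p)) <|
    Matrix.vecCons (Matrix.vecCons (u + s) (Matrix.vecCons (u - s) fun i => u * p i)) fun j =>
      Matrix.vecCons (2 * α j) (Matrix.vecCons (2 * α j) fun i =>
        (if j = i then 1 else 0) + 2 * α j * p i)

theorem Amat_eq_vecCons {N : ℕ} (g h u : ℝ) (α : Fin N → ℝ) :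
    Amat N g h u α = Matrix.of (Matrix.vecCons (Matrix.vecCons 0 (Matrix.vecCons 1 fun _ => 0)) <|
      Matrix.vecCons
        (Matrix.vecCons (g * h - u ^ 2 - ∑ i, α i ^ 2 / (2 * ((i : ℕ) : ℝ) + 3))
          (Matrix.vecCons (2 * u) fun i => 2 * α i / (2 * ((i : ℕ) : ℝ) + 3))) fun j =>
        Matrix.vecCons (-2 * u * α j) (Matrix.vecCons (2 * α j) fun i =>
          if j = i then u else 0)) := by
  ext r c
  refine Fin.cases ?_ (Fin.cases ?_ fun j => ?_) r <;>
    refine Fin.cases ?_ (Fin.cases ?_ fun i => ?_) c <;>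
    simp [Amat, Fin.ext_iff, -Fin.val_eq_zero_iff, eq_comm]

theorem isUnit_eigenvectorMatrix {N : ℕ} (u s : ℝ) (α p : Fin N → ℝ) (hs : s ≠ 0) :
    IsUnit (eigenvectorMatrix u s α p) := by
  rw [← Matrix.mulVec_injective_iff_isUnit, ← Matrix.coe_mulVecLin, injective_iff_map_eq_zero]
  intro v hv
  have h0 := congrFun hv 0
  have h1 := congrFun hv 1
  have h2 := fun j : Fin N => congrFun hv j.succ.succ
  simp only [Matrix.mulVecLin_apply, Matrix.mulVec, dotProduct, eigenvectorMatrix,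
    Fin.sum_univ_succ, Matrix.of_apply, Matrix.cons_val_zero, Matrix.cons_val_one,
    Matrix.cons_val_succ, Pi.zero_apply, Fin.succ_zero_eq_one, add_mul, ite_mul, one_mul, zero_mul,
    mul_assoc, Finset.sum_add_distrib, ← Finset.mul_sum, Finset.sum_ite_eq, Finset.mem_univ,
    if_true] at h0 h1 h2
  have hv2 : ∀ j : Fin N, v j.succ.succ = 0 := fun j => by
    linear_combination h2 j - 2 * α j * h0
  simp only [hv2, mul_zero, Finset.sum_const_zero, add_zero] at h0 h1
  have h01 : v 0 - v 1 = 0 := by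
    refine (mul_eq_zero.1 ?_).resolve_left hs
    linear_combination h1 - u * h0
  ext r
  refine Fin.cases ?_ (Fin.cases ?_ hv2) r
  · simp only [Pi.zero_apply]
    linarith
  · simp only [Pi.zero_apply, Fin.succ_zero_eq_one]
    linarith

theorem Amat_mul_eigenvectorMatrix {N : ℕ} (g h u s : ℝ) (α p : Fin N → ℝ)
    (hs : s ^ 2 = g * h + 3 * ∑ i, α i ^ 2 / (2 * ((i : ℕ) : ℝ) + 3))
    (hp : ∀ i, s ^ 2 * p i = -(2 * α i / (2 * ((i : ℕ) : ℝ) + 3))) :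
    Amat N g h u α * eigenvectorMatrix u s α p = eigenvectorMatrix u s α p *
      Matrix.diagonal (Matrix.vecCons (u + s) (Matrix.vecCons (u - s) fun _ => u)) := by
  have hsum : ∑ i, 2 * α i / (2 * ((i : ℕ) : ℝ) + 3) * 2 * α i =
      4 * ∑ i, α i ^ 2 / (2 * ((i : ℕ) : ℝ) + 3) := by
    rw [Finset.mul_sum]
    exact Finset.sum_congr rfl fun i _ => by ring
  rw [Amat_eq_vecCons]
  ext r c
  rw [Matrix.mul_diagonal, Matrix.mul_apply]
  refine Fin.cases ?_ (Fin.cases ?_ fun j => ?_) r <;>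
    refine Fin.cases ?_ (Fin.cases ?_ fun i => ?_) c <;>
    simp only [eigenvectorMatrix, Fin.sum_univ_succ, Matrix.of_apply, Matrix.cons_val_zero,
      Matrix.cons_val_one, Matrix.cons_val_succ, Fin.succ_zero_eq_one, zero_mul, one_mul, ite_mul,
      mul_add, mul_ite, mul_one, mul_zero, ← mul_assoc, Finset.sum_add_distrib, ← Finset.sum_mul,
      Finset.sum_ite_eq, Finset.sum_ite_eq', Finset.mem_univ, if_true, Finset.sum_const_zero]
  · ring
  · ring
  · ring
  · linear_combination hsum - hs
  · linear_combination hsum - hs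
  · linear_combination p i * (hsum - hs) + hp i
  · ring
  · ring
  · split_ifs <;> ring

/-- If `g > 0` and `h > 0`, then `A` is diagonalizable over `ℝ`: there exist an
invertible matrix `T` and a diagonal matrix `D` with `A = T D T⁻¹`. -/
theorem Amat_diagonalizable {N : ℕ} (hN : 1 ≤ N) (g h u : ℝ) (α : Fin N → ℝ)
    (hg : 0 < g) (hh : 0 < h) :
    ∃ T D : Matrix (Fin (N + 2)) (Fin (N + 2)) ℝ,
      IsUnit T ∧ D.IsDiag ∧ Amat N g h u α = T * D * T⁻¹ := by
  obtain ⟨hc, hs⟩ : 0 < g * h + 3 * ∑ i, α i ^ 2 / (2 * ((i : ℕ) : ℝ) + 3) ∧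
      √(g * h + 3 * ∑ i, α i ^ 2 / (2 * ((i : ℕ) : ℝ) + 3)) ^ 2 =
        g * h + 3 * ∑ i, α i ^ 2 / (2 * ((i : ℕ) : ℝ) + 3) := by
    have hc : 0 < g * h + 3 * ∑ i, α i ^ 2 / (2 * ((i : ℕ) : ℝ) + 3) := by positivity
    exact ⟨hc, Real.sq_sqrt hc.le⟩
  set s := √(g * h + 3 * ∑ i, α i ^ 2 / (2 * ((i : ℕ) : ℝ) + 3))
  have hs0 : s ≠ 0 := by
    rintro h0
    rw [h0] at hs
    linarith
  have hT := isUnit_eigenvectorMatrix u s α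
    (fun i => -(2 * α i / (2 * ((i : ℕ) : ℝ) + 3)) / s ^ 2) hs0
  refine ⟨_, _, hT, Matrix.isDiag_diagonal
    (Matrix.vecCons (u + s) (Matrix.vecCons (u - s) fun _ => u)), ?_⟩
  rw [← Amat_mul_eigenvectorMatrix g h u s α _ hs fun i => mul_div_cancel₀ _ (pow_ne_zero 2 hs0),
    Matrix.mul_nonsing_inv_cancel_right _ _ ((Matrix.isUnit_iff_isUnit_det _).1 hT)]
end
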